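/- Let f : [0,∞) → ℝ be operator convex, let L_1,…,L_n be positive operators on H and R_1,…,R_n strictly positive operators on H with ∑_{i=1}^n R_i = I. Then f(∑_{i=1}^n L_i) ≤ ∑_{i=1}^n R_i^{1/2} f(R_i^{−1/2} L_i R_i^{−1/2}) R_i^{1/2} = ∑_{i=1}^n g(L_i,R_i) in the Loewner order. -/

import Mathlib

open scoped InnerProductSpace

noncomputable section

/-- A continuous function `f : [0, ∞) → ℝ` is *operator convex* if for every complex Hilbert
space `K`, all selfadjoint operators `A, B` on `K` with spectra in `[0, ∞)` and every
`λ ∈ [0, 1]` one has `f(λA + (1-λ)B) ≤ λ f(A) + (1-λ) f(B)` in the Loewner order, where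
`f(A)` is given by the continuous functional calculus. -/
def OperatorConvexOn (f : ℝ → ℝ) : Prop :=
  ∀ (K : Type) [NormedAddCommGroup K] [InnerProductSpace ℂ K] [CompleteSpace K],
    ∀ A B : K →L[ℂ] K, IsSelfAdjoint A → IsSelfAdjoint B →
      spectrum ℝ A ⊆ Set.Ici (0 : ℝ) → spectrum ℝ B ⊆ Set.Ici (0 : ℝ) →
      ∀ lam : ℝ, lam ∈ Set.Icc (0 : ℝ) 1 →
        cfc f (lam • A + (1 - lam) • B) ≤ lam • cfc f A + (1 - lam) • cfc f B

variable {H : Type} [NormedAddCommGroup H] [InnerProductSpace ℂ H] [CompleteSpace H]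

/-- `R^{1/2}` via the continuous functional calculus. -/
def opSqrt (R : H →L[ℂ] H) : H →L[ℂ] H := cfc Real.sqrt R

/-- `R^{-1/2}` via the continuous functional calculus. -/
def opInvSqrt (R : H →L[ℂ] H) : H →L[ℂ] H := cfc (fun t : ℝ => (Real.sqrt t)⁻¹) R

/-- The non-commutative perspective `g(L, R) = R^{1/2} f(R^{-1/2} L R^{-1/2}) R^{1/2}`. -/
def persp (f : ℝ → ℝ) (L R : H →L[ℂ] H) : H →L[ℂ] H :=
  opSqrt R * cfc f (opInvSqrt R * L * opInvSqrt R) * opSqrt R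

/-- The pairs `(A, B)` that, together with their adjoints, are intertwined by `V`, as a
star subalgebra. -/
def intertwiners {K : Type} [NormedAddCommGroup K] [InnerProductSpace ℂ K] [CompleteSpace K]
    (V : H →L[ℂ] K) : StarSubalgebra ℝ ((K →L[ℂ] K) × (H →L[ℂ] H)) where
  carrier := {p | p.1 ∘L V = V ∘L p.2 ∧ (star p.1) ∘L V = V ∘L (star p.2)}
  mul_mem' := by
    have comp_mul {A A' : K →L[ℂ] K} {B B' : H →L[ℂ] H} (h : A ∘L V = V ∘L B)
        (h' : A' ∘L V = V ∘L B') : (A * A') ∘L V = V ∘L (B * B') := by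
      ext x
      exact congr(A ($h' x)).trans congr($h (B' x))
    rintro ⟨A, B⟩ ⟨A', B'⟩ ⟨h, hs⟩ ⟨h', hs'⟩
    refine ⟨comp_mul h h', ?_⟩
    simpa only [Prod.mk_mul_mk, star_mul] using comp_mul hs' hs
  add_mem' := by
    rintro ⟨A, B⟩ ⟨A', B'⟩ ⟨h, hs⟩ ⟨h', hs'⟩
    simp_all [ContinuousLinearMap.add_comp, ContinuousLinearMap.comp_add]
  algebraMap_mem' r := by
    constructor <;> ext x <;> simp [Algebra.algebraMap_eq_smul_one]
  star_mem' := by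
    rintro ⟨A, B⟩ ⟨h, hs⟩
    exact ⟨hs, by simpa using h⟩

theorem isClosed_intertwiners {K : Type} [NormedAddCommGroup K] [InnerProductSpace ℂ K]
    [CompleteSpace K] (V : H →L[ℂ] K) :
    IsClosed (intertwiners V : Set ((K →L[ℂ] K) × (H →L[ℂ] H))) := by
  refine (isClosed_eq ?_ ?_).inter (isClosed_eq ?_ ?_) <;> fun_prop

theorem cfc_comp_eq_comp_cfc {K : Type} [NormedAddCommGroup K] [InnerProductSpace ℂ K]
    [CompleteSpace K] {V : H →L[ℂ] K} {A : K →L[ℂ] K} {B : H →L[ℂ] H}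
    (hA : IsSelfAdjoint A) (hB : IsSelfAdjoint B) (hV : A ∘L V = V ∘L B) {f : ℝ → ℝ}
    (hf : ContinuousOn f (spectrum ℝ A ∪ spectrum ℝ B)) :
    cfc f A ∘L V = V ∘L cfc f B := by
  have hAB : IsSelfAdjoint (A, B) := Prod.ext hA hB
  have hmem : (A, B) ∈ intertwiners V := ⟨hV, by simpa [hA.star_eq, hB.star_eq] using hV⟩
  have h1 : StarAlgebra.elemental ℝ (A, B) ≤ intertwiners V :=
    StarAlgebra.elemental.le_of_mem (isClosed_intertwiners V) hmem
  have : ContinuousFunctionalCalculus ℝ ((K →L[ℂ] K) × (H →L[ℂ] H)) IsSelfAdjoint :=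
    IsSelfAdjoint.instContinuousFunctionalCalculus
  have h2 := h1 (cfc_mem_elemental f (A, B))
  rw [cfc_map_prod (S := ℂ) f A B hf hAB hA hB] at h2
  exact h2.1

/-- Jensen's operator inequality for an isometry `V`. -/
theorem OperatorConvexOn.cfc_adjoint_conj_le {K : Type} [NormedAddCommGroup K]
    [InnerProductSpace ℂ K] [CompleteSpace K] {f : ℝ → ℝ}
    (hf_cont : ContinuousOn f (Set.Ici (0 : ℝ))) (hf : OperatorConvexOn f)
    {V : H →L[ℂ] K} (hV : V.adjoint ∘L V = 1) {X : K →L[ℂ] K} (hX : 0 ≤ X) :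
    cfc f (V.adjoint ∘L X ∘L V) ≤ V.adjoint ∘L cfc f X ∘L V := by
  have hVx (x : H) : V.adjoint (V x) = x := congr($hV x)
  have nonneg_spec {E : Type} [NormedAddCommGroup E] [InnerProductSpace ℂ E] [CompleteSpace E]
      {T : E →L[ℂ] E} (hT : 0 ≤ T) : spectrum ℝ T ⊆ Set.Ici 0 :=
    fun _ hx => spectrum_nonneg_of_nonneg hT hx
  set P : K →L[ℂ] K := V ∘L V.adjoint with hP
  set U : K →L[ℂ] K := (2 : ℝ) • P - 1 with hU
  have hPsa : star P = P := by
    simp [hP, ContinuousLinearMap.star_eq_adjoint, ContinuousLinearMap.adjoint_comp]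
  have hUsa : star U = U := by simp [hU, hPsa]
  have hPP : P * P = P := by ext x; simp [hP, hVx]
  have hUU : U * U = 1 := by
    simp only [hU, sub_mul, mul_sub, smul_mul_assoc, mul_smul_comm, hPP, one_mul, mul_one]
    module
  have hUV : U ∘L V = V := by ext x; simp [hU, hP, hVx, two_smul]
  have hVU : V.adjoint ∘L U = V.adjoint := by
    have := congr(ContinuousLinearMap.adjoint $hUV)
    rwa [ContinuousLinearMap.adjoint_comp, ← ContinuousLinearMap.star_eq_adjoint U, hUsa] at this
  have hX' : 0 ≤ U * X * U := by simpa [hUsa] using star_left_conjugate_nonneg hX U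
  have hZ : 0 ≤ V.adjoint ∘L X ∘L V := by
    rw [ContinuousLinearMap.nonneg_iff_isPositive] at hX ⊢
    exact hX.adjoint_conj V
  have key := hf K X (U * X * U) hX.isSelfAdjoint hX'.isSelfAdjoint (nonneg_spec hX)
    (nonneg_spec hX') (1 / 2) (by norm_num)
  set Y : K →L[ℂ] K := (1 / 2 : ℝ) • X + (1 - 1 / 2 : ℝ) • (U * X * U) with hY
  have hY0 : 0 ≤ Y := add_nonneg (smul_nonneg (by norm_num) hX) (smul_nonneg (by norm_num) hX')
  have hcont {E F : Type} [NormedAddCommGroup E] [InnerProductSpace ℂ E] [CompleteSpace E]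
      [NormedAddCommGroup F] [InnerProductSpace ℂ F] [CompleteSpace F]
      {S : E →L[ℂ] E} {T : F →L[ℂ] F} (hS : 0 ≤ S) (hT : 0 ≤ T) :
      ContinuousOn f (spectrum ℝ S ∪ spectrum ℝ T) :=
    hf_cont.mono (Set.union_subset (nonneg_spec hS) (nonneg_spec hT))
  have hUVx (x : H) : U (V x) = V x := congr($hUV x)
  have hVUx (x : K) : V.adjoint (U x) = V.adjoint x := congr($hVU x)
  have hYV : Y ∘L V = V ∘L (V.adjoint ∘L X ∘L V) := by
    ext x
    simp only [hY, ContinuousLinearMap.comp_apply, add_apply, smul_apply,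
      mul_apply_eq_comp, hUVx]
    simp only [hU, hP, sub_apply, smul_apply, ContinuousLinearMap.comp_apply,
      one_apply_eq_self]
    module
  have hfY := cfc_comp_eq_comp_cfc hY0.isSelfAdjoint hZ.isSelfAdjoint hYV (hcont hY0 hZ)
  have hfU : cfc f (U * X * U) * U = U * cfc f X :=
    cfc_comp_eq_comp_cfc hX'.isSelfAdjoint hX.isSelfAdjoint
      (show U * X * U * U = U * X by rw [mul_assoc, hUU, mul_one]) (hcont hX' hX)
  have hconj := sub_nonneg.2 key
  rw [ContinuousLinearMap.nonneg_iff_isPositive] at hconj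
  have hconj' := hconj.adjoint_conj V
  rw [← ContinuousLinearMap.nonneg_iff_isPositive] at hconj'
  rw [← sub_nonneg]
  convert hconj' using 1
  ext x
  have h1 : cfc f Y (V x) = V (cfc f (V.adjoint ∘L X ∘L V) x) := congr($hfY x)
  have h2 : cfc f (U * X * U) (V x) = U (cfc f X (V x)) := by
    have := congr($hfU (V x))
    simpa [hUVx] using this
  simp only [ContinuousLinearMap.comp_apply, add_apply, sub_apply, smul_apply, h1, h2, map_sub,
    map_add, hVx, ContinuousLinearMap.map_smul_of_tower, hVUx]
  module

/-- The `i`-th coordinate embedding into the `ℓ²` direct sum. -/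
def coordEmbedding {n : ℕ} (i : Fin n) : H →L[ℂ] PiLp 2 (fun _ : Fin n => H) :=
  (PiLp.proj 2 (fun _ : Fin n => H) i : _ →L[ℂ] H).adjoint

theorem coordEmbedding_apply {n : ℕ} (i : Fin n) (x : H) :
    coordEmbedding i x = PiLp.single 2 i x := by
  refine ext_inner_right ℂ fun y => ?_
  rw [coordEmbedding, ContinuousLinearMap.adjoint_inner_left, PiLp.inner_apply,
    Finset.sum_eq_single i] <;> simp +contextual

theorem adjoint_coordEmbedding_apply {n : ℕ} (i j : Fin n) (x : H) :
    (coordEmbedding i).adjoint (coordEmbedding j x) = if i = j then x else 0 := by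
  rw [coordEmbedding_apply, coordEmbedding, ContinuousLinearMap.adjoint_adjoint]
  split_ifs with h
  · subst h; simp
  · simp [h]

theorem OperatorConvexOn.cfc_sum_conj_le {f : ℝ → ℝ}
    (hf_cont : ContinuousOn f (Set.Ici (0 : ℝ))) (hf : OperatorConvexOn f) {n : ℕ}
    {C X : Fin n → H →L[ℂ] H} (hC : ∑ i, star (C i) * C i = 1) (hX : ∀ i, 0 ≤ X i) :
    cfc f (∑ i, star (C i) * X i * C i) ≤ ∑ i, star (C i) * cfc f (X i) * C i := by
  let V : H →L[ℂ] PiLp 2 (fun _ : Fin n => H) := ∑ i, coordEmbedding i ∘L C i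
  let D : PiLp 2 (fun _ : Fin n => H) →L[ℂ] PiLp 2 (fun _ : Fin n => H) :=
    ∑ i, coordEmbedding i ∘L X i ∘L (coordEmbedding i).adjoint
  have hD : 0 ≤ D := Finset.sum_nonneg fun i _ => by
    have h := hX i
    rw [ContinuousLinearMap.nonneg_iff_isPositive] at h ⊢
    exact h.conj_adjoint _
  have hDi (i : Fin n) : D ∘L coordEmbedding i = coordEmbedding i ∘L X i := by
    ext1 x
    simp [D, adjoint_coordEmbedding_apply, apply_ite]
  have hconj (T : PiLp 2 (fun _ : Fin n => H) →L[ℂ] PiLp 2 (fun _ : Fin n => H))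
      (S : Fin n → H →L[ℂ] H) (h : ∀ i, T ∘L coordEmbedding i = coordEmbedding i ∘L S i) :
      V.adjoint ∘L T ∘L V = ∑ i, star (C i) * S i * C i := by
    have h' (i : Fin n) (x : H) : T (coordEmbedding i x) = coordEmbedding i (S i x) :=
      congr($(h i) x)
    ext x
    simp [V, h', ContinuousLinearMap.adjoint_comp,
      adjoint_coordEmbedding_apply, apply_ite, ContinuousLinearMap.star_eq_adjoint]
  have hV : V.adjoint ∘L V = 1 := by
    have := hconj 1 (fun _ => 1) (fun i => rfl)
    simp_rw [mul_one, hC] at this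
    exact this
  have hfD (i : Fin n) : cfc f D ∘L coordEmbedding i = coordEmbedding i ∘L cfc f (X i) :=
    cfc_comp_eq_comp_cfc hD.isSelfAdjoint (hX i).isSelfAdjoint (hDi i) <|
      hf_cont.mono <| Set.union_subset (fun _ hx => spectrum_nonneg_of_nonneg hD hx)
        fun _ hx => spectrum_nonneg_of_nonneg (hX i) hx
  have := hf.cfc_adjoint_conj_le hf_cont hV hD
  rwa [hconj D X hDi, hconj _ _ hfD] at this

theorem star_opSqrt (R : H →L[ℂ] H) : star (opSqrt R) = opSqrt R :=
  (cfc_predicate Real.sqrt R : IsSelfAdjoint _).star_eq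

theorem star_opInvSqrt (R : H →L[ℂ] H) : star (opInvSqrt R) = opInvSqrt R :=
  (cfc_predicate _ R : IsSelfAdjoint _).star_eq

theorem opSqrt_mul_self {R : H →L[ℂ] H} (hR : 0 ≤ R) : opSqrt R * opSqrt R = R := by
  rw [opSqrt, ← cfc_mul Real.sqrt Real.sqrt R]
  conv_rhs => rw [← cfc_id ℝ R hR.isSelfAdjoint]
  exact cfc_congr fun x hx => Real.mul_self_sqrt (spectrum_nonneg_of_nonneg hR hx)

theorem sqrt_pos_of_mem_spectrum {R : H →L[ℂ] H} (hR : 0 ≤ R) (hu : IsUnit R) {x : ℝ}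
    (hx : x ∈ spectrum ℝ R) : 0 < √x :=
  Real.sqrt_pos.2 <| (spectrum_nonneg_of_nonneg hR hx).lt_of_ne fun h =>
    spectrum.zero_notMem ℝ hu (h ▸ hx)

theorem opSqrt_mul_opInvSqrt {R : H →L[ℂ] H} (hR : 0 ≤ R) (hu : IsUnit R) :
    opSqrt R * opInvSqrt R = 1 := by
  have hsa : IsSelfAdjoint R := hR.isSelfAdjoint
  have hpos {x : ℝ} (hx : x ∈ spectrum ℝ R) := (sqrt_pos_of_mem_spectrum hR hu hx).ne'
  rw [opSqrt, opInvSqrt, ← cfc_mul Real.sqrt (fun t => (√t)⁻¹) R (by fun_prop)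
    (Real.continuous_sqrt.continuousOn.inv₀ fun x hx => hpos hx), ← cfc_one ℝ R]
  exact cfc_congr fun x hx => mul_inv_cancel₀ (hpos hx)

/-- If `∑ R i = I`, then `f(∑ L i) ≤ ∑ i, g(L i, R i)`. -/
theorem stmt_2 (f : ℝ → ℝ) (hf_cont : ContinuousOn f (Set.Ici (0 : ℝ)))
    (hf : OperatorConvexOn f) (n : ℕ)
    (L R : Fin n → H →L[ℂ] H)
    (hL : ∀ i, 0 ≤ L i) (hR : ∀ i, 0 ≤ R i ∧ IsUnit (R i))
    (hRsum : ∑ i, R i = 1) :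
    cfc f (∑ i, L i) ≤ ∑ i, persp f (L i) (R i) := by
  have hX (i : Fin n) : 0 ≤ opInvSqrt (R i) * L i * opInvSqrt (R i) := by
    simpa [star_opInvSqrt] using star_left_conjugate_nonneg (hL i) (opInvSqrt (R i))
  have hC : ∑ i, star (opSqrt (R i)) * opSqrt (R i) = 1 := by
    simp_rw [star_opSqrt, fun i => opSqrt_mul_self (hR i).1, hRsum]
  have hLi (i : Fin n) : opSqrt (R i) * (opInvSqrt (R i) * L i * opInvSqrt (R i)) *
      opSqrt (R i) = L i := by
    have h := opSqrt_mul_opInvSqrt (hR i).1 (hR i).2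
    have h' : opInvSqrt (R i) * opSqrt (R i) = 1 := by
      simpa [star_opSqrt, star_opInvSqrt] using congr(star $h)
    rw [mul_assoc, mul_assoc, h', mul_one, ← mul_assoc, h, one_mul]
  have := hf.cfc_sum_conj_le hf_cont hC hX
  simpa only [star_opSqrt, hLi, persp] using this
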